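/- arXiv:math/9809028 — 4 statements merged into one kernel-verified Lean document; each statement's English description precedes it below -/
import Mathlib

section
/- Let ξ : ℝᵖ → ℝᵖ be a C² vector field whose flow φ : ℝ × ℝᵖ → ℝᵖ is globally defined (∂ₜφₜ(x) = ξ(φₜ(x)), φ₀ = id) and C² in the space variable. Fix x₀ ∈ ℝᵖ, δ > 0 and v, w ∈ ℝᵖ, and write xₜ := φₜ(x₀). Then the second derivative of the time-δ flow map satisfies D²φ_δ(x₀)(v, w) = ∫₀^δ Dφ_{δ−t}(xₜ) · D²ξ(xₜ)(Dφₜ(x₀)v, Dφₜ(x₀)w) dt. -/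
open Set Filter Topology

/-- Trajectories of a `C¹` vector field starting close enough to a given one stay at distance
controlled by the initial distance, over a bounded time interval `[0, T]`. -/
theorem exists_dist_trajectories_le_of_nonneg {F : Type*} [NormedAddCommGroup F] [NormedSpace ℝ F]
    [FiniteDimensional ℝ F] {X : F → F} (hX : ContDiff ℝ 1 X) {f : ℝ → F}
    (hf : ∀ t, HasDerivAt f (X (f t)) t) (T : ℝ) :
    ∃ ε > 0, ∃ C ≥ 0, ∀ g : ℝ → F, (∀ t, HasDerivAt g (X (g t)) t) → dist (g 0) (f 0) < ε →
      ∀ s ∈ Icc 0 T, dist (g s) (f s) ≤ C * dist (g 0) (f 0) ∧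
        dist (X (g s)) (X (f s)) ≤ C * dist (g 0) (f 0) := by
  have hfc : Continuous f := continuous_iff_continuousAt.2 fun t => (hf t).continuousAt
  obtain ⟨R, hR⟩ := (isCompact_Icc (a := (0 : ℝ)) (b := T)).image hfc |>.isBounded.subset_closedBall
    (0 : F)
  have hfR : ∀ s ∈ Icc 0 T, f s ∈ Metric.closedBall 0 (R + 1) := fun s hs =>
    Metric.closedBall_subset_closedBall (by linarith) (hR (mem_image_of_mem f hs))
  obtain ⟨L, hL⟩ := (hX.contDiffOn (s := Metric.closedBall 0 (R + 1))).exists_lipschitzOnWith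
    one_ne_zero (convex_closedBall _ _) (isCompact_closedBall (0 : F) (R + 1))
  set K : ℝ := Real.exp (L * T)
  have hK : 0 < K := Real.exp_pos _
  refine ⟨K⁻¹, by positivity, K + L * K, by positivity, fun g hg hg0 => ?_⟩
  have hgc : Continuous g := continuous_iff_continuousAt.2 fun t => (hg t).continuousAt
  have hgR : ∀ s ∈ Icc 0 T, dist (g s) (f s) < 1 → g s ∈ Metric.closedBall 0 (R + 1) := by
    intro s hs h
    have h1 := hR (mem_image_of_mem f hs)
    rw [Metric.mem_closedBall] at h1 ⊢
    linarith [dist_triangle (g s) (f s) 0]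
  have gronwall : ∀ s ∈ Icc 0 T, (∀ r ∈ Ico 0 s, dist (g r) (f r) < 1) →
      dist (g s) (f s) ≤ K * dist (g 0) (f 0) := by
    intro s hs h
    have := dist_le_of_trajectories_ODE_of_mem (v := fun _ => X) (K := L) (a := 0) (b := s)
      (s := fun _ => Metric.closedBall 0 (R + 1)) (fun _ _ => hL) hgc.continuousOn
      (fun t _ => (hg t).hasDerivWithinAt)
      (fun t ht => hgR t ⟨ht.1, ht.2.le.trans hs.2⟩ (h t ht)) hfc.continuousOn
      (fun t _ => (hf t).hasDerivWithinAt) (fun t ht => hfR t ⟨ht.1, ht.2.le.trans hs.2⟩)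
      le_rfl s ⟨hs.1, le_rfl⟩
    rw [sub_zero, mul_comm] at this
    refine this.trans (mul_le_mul_of_nonneg_right (Real.exp_le_exp.2 ?_) dist_nonneg)
    gcongr
    exact hs.2
  have hlt : dist (g 0) (f 0) * K < 1 := by
    rwa [← lt_div_iff₀ hK, one_div]
  have hclose : ∀ s ∈ Icc 0 T, dist (g s) (f s) < 1 := by
    by_contra! hne
    obtain ⟨s₁, hs₁, h₁⟩ := hne
    have hcomp : IsCompact (Icc 0 T ∩ {s | 1 ≤ dist (g s) (f s)}) :=
      isCompact_Icc.inter_right (isClosed_le continuous_const (hgc.dist hfc))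
    obtain ⟨s, ⟨hs, h⟩, hmin⟩ := hcomp.exists_isLeast ⟨s₁, hs₁, h₁⟩
    have := gronwall s hs fun r hr => by
      by_contra! hr1
      exact absurd (hmin ⟨⟨hr.1, hr.2.le.trans hs.2⟩, hr1⟩) (not_le.2 hr.2)
    have h' : 1 ≤ dist (g s) (f s) := h
    linarith [mul_comm K (dist (g 0) (f 0))]
  intro s hs
  have h1 := gronwall s hs fun r hr => hclose r ⟨hr.1, hr.2.le.trans hs.2⟩
  have h2 := hL.dist_le_mul _ (hgR s hs (hclose s hs)) _ (hfR s hs)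
  have h3 : L * dist (g s) (f s) ≤ L * (K * dist (g 0) (f 0)) := by gcongr
  have h4 : 0 ≤ L * K * dist (g 0) (f 0) := by positivity
  have h5 : 0 ≤ K * dist (g 0) (f 0) := by positivity
  constructor <;> linarith

/-- Two-sided version of `exists_dist_trajectories_le_of_nonneg`. -/
theorem exists_dist_trajectories_le {F : Type*} [NormedAddCommGroup F] [NormedSpace ℝ F]
    [FiniteDimensional ℝ F] {X : F → F} (hX : ContDiff ℝ 1 X) {f : ℝ → F}
    (hf : ∀ t, HasDerivAt f (X (f t)) t) (T : ℝ) :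
    ∃ ε > 0, ∃ C ≥ 0, ∀ g : ℝ → F, (∀ t, HasDerivAt g (X (g t)) t) → dist (g 0) (f 0) < ε →
      ∀ s ∈ Icc (-T) T, dist (g s) (f s) ≤ C * dist (g 0) (f 0) ∧
        dist (X (g s)) (X (f s)) ≤ C * dist (g 0) (f 0) := by
  have reverse : ∀ g : ℝ → F, (∀ t, HasDerivAt g (X (g t)) t) →
      ∀ t, HasDerivAt (fun s => g (-s)) ((-X) (g (-t))) t := fun g hg t => by
    simpa [Function.comp_def] using (hg (-t)).scomp t (hasDerivAt_neg t)
  obtain ⟨ε₁, hε₁, C₁, hC₁, h₁⟩ := exists_dist_trajectories_le_of_nonneg hX hf T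
  obtain ⟨ε₂, hε₂, C₂, hC₂, h₂⟩ := exists_dist_trajectories_le_of_nonneg hX.neg (reverse f hf) T
  refine ⟨min ε₁ ε₂, lt_min hε₁ hε₂, max C₁ C₂, le_max_of_le_left hC₁, fun g hg h0 s hs => ?_⟩
  have hd := dist_nonneg (x := g 0) (y := f 0)
  rcases le_total 0 s with h | h
  · obtain ⟨ha, hb⟩ := h₁ g hg (h0.trans_le (min_le_left _ _)) s ⟨h, hs.2⟩
    have := mul_le_mul_of_nonneg_right (le_max_left C₁ C₂) hd
    exact ⟨ha.trans this, hb.trans this⟩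
  · obtain ⟨ha, hb⟩ := h₂ (fun s => g (-s)) (reverse g hg)
      (by simpa using h0.trans_le (min_le_right _ _)) (-s) ⟨by linarith, by linarith [hs.1]⟩
    have := mul_le_mul_of_nonneg_right (le_max_right C₁ C₂) hd
    simp only [neg_neg, neg_zero, dist_neg_neg] at ha hb
    exact ⟨ha.trans this, hb.trans this⟩

theorem trajectory_unique {F : Type*} [NormedAddCommGroup F] [NormedSpace ℝ F]
    [FiniteDimensional ℝ F] {X : F → F} (hX : ContDiff ℝ 1 X) {f g : ℝ → F}
    (hf : ∀ t, HasDerivAt f (X (f t)) t) (hg : ∀ t, HasDerivAt g (X (g t)) t)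
    (h0 : g 0 = f 0) : g = f := by
  funext t
  obtain ⟨ε, hε, C, -, h⟩ := exists_dist_trajectories_le hX hf |t|
  have := (h g hg (by simpa [h0] using hε) t ⟨neg_abs_le t, le_abs_self t⟩).1
  simpa [h0] using this

theorem flow_add {F : Type*} [NormedAddCommGroup F] [NormedSpace ℝ F]
    [FiniteDimensional ℝ F] {X : F → F} (hX : ContDiff ℝ 1 X) {φ : ℝ → F → F}
    (hφ0 : ∀ x, φ 0 x = x) (hφ : ∀ t x, HasDerivAt (fun s => φ s x) (X (φ t x)) t)
    (s t : ℝ) (x : F) : φ s (φ t x) = φ (s + t) x :=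
  congrFun (trajectory_unique hX (fun s => (hφ (s + t) x).comp_add_const s t)
    (fun s => hφ s (φ t x)) (by simp [hφ0])) s

/-- The variational equation along a flow whose time-`t` maps are differentiable. -/
theorem hasDerivAt_fderiv_flow {F : Type*} [NormedAddCommGroup F] [NormedSpace ℝ F]
    [FiniteDimensional ℝ F] {X : F → F} (hX : ContDiff ℝ 1 X) {φ : ℝ → F → F}
    (hφ0 : ∀ x, φ 0 x = x) (hφ : ∀ t x, HasDerivAt (fun s => φ s x) (X (φ t x)) t)
    {z : F} (hd : ∀ t, DifferentiableAt ℝ (φ t) z) (u : F) (t : ℝ) :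
    HasDerivAt (fun s => fderiv ℝ (φ s) z u) (fderiv ℝ X (φ t z) (fderiv ℝ (φ t) z u)) t := by
  have hc : ∀ x, Continuous fun s => φ s x := fun x =>
    continuous_iff_continuousAt.2 fun t => (hφ t x).continuousAt
  have hXc : ∀ x, Continuous fun s => X (φ s x) := fun x => hX.continuous.comp (hc x)
  set q : ℝ → F := fun s => fderiv ℝ X (φ s z) (fderiv ℝ (φ s) z u)
  set Q : ℝ → ℝ → F := fun h s => h⁻¹ • (X (φ s (z + h • u)) - X (φ s z)) with hQ
  have slope : ∀ {G : F → F} {G' : F →L[ℝ] F}, HasFDerivAt G G' z →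
      Tendsto (fun h : ℝ => h⁻¹ • (G (z + h • u) - G z)) (𝓝[≠] 0) (𝓝 (G' u)) := fun hG =>
    (hG.hasLineDerivAt u).tendsto_slope_zero
  have hQc : ∀ h, Continuous (Q h) := fun h =>
    ((hXc _).sub (hXc _)).const_smul _
  have hQq : ∀ s, Tendsto (fun h => Q h s) (𝓝[≠] 0) (𝓝 (q s)) := fun s =>
    slope (G := X ∘ φ s) (((hX.differentiable one_ne_zero _).hasFDerivAt).comp z (hd s).hasFDerivAt)
  have hbound : ∀ T, ∃ M, ∀ᶠ h in 𝓝[≠] (0 : ℝ), ∀ s ∈ Icc (-T) T, ‖Q h s‖ ≤ M := by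
    intro T
    obtain ⟨ε, hε, C, hC, H⟩ := exists_dist_trajectories_le hX (fun t => hφ t z) T
    have hsmall : ∀ᶠ h in 𝓝[≠] (0 : ℝ), ‖h • u‖ < ε := by
      have : Tendsto (fun h : ℝ => ‖h • u‖) (𝓝[≠] 0) (𝓝 0) := by
        refine Tendsto.mono_left ?_ nhdsWithin_le_nhds
        exact Continuous.tendsto' (by fun_prop) _ _ (by simp)
      exact this.eventually_lt_const hε
    refine ⟨C * ‖u‖, ?_⟩
    filter_upwards [hsmall, self_mem_nhdsWithin] with h hh hne s hs
    have hne : h ≠ 0 := hne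
    have := (H _ (fun t => hφ t (z + h • u)) (by simpa [hφ0] using hh) s hs).2
    rw [dist_eq_norm] at this
    simp only [hφ0, dist_self_add_left, norm_smul] at this
    rw [hQ, norm_smul, norm_inv, inv_mul_le_iff₀ (norm_pos_iff.2 hne)]
    linarith
  have hqm : MeasureTheory.StronglyMeasurable q :=
    stronglyMeasurable_of_tendsto (𝓝[≠] (0 : ℝ)) (fun h => (hQc h).stronglyMeasurable)
      (tendsto_pi_nhds.2 hQq)
  have huIoc : ∀ {a b s : ℝ}, s ∈ uIoc a b → s ∈ Icc (-max |a| |b|) (max |a| |b|) := by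
    intro a b s hs
    have h := uIoc_subset_uIcc hs
    rw [mem_uIcc] at h
    have := neg_abs_le a
    have := neg_abs_le b
    have := le_abs_self a
    have := le_abs_self b
    have := le_max_left |a| |b|
    have := le_max_right |a| |b|
    rcases h with h | h <;> constructor <;> linarith [h.1, h.2]
  have hqi : ∀ a b, IntervalIntegrable q MeasureTheory.volume a b := by
    intro a b
    obtain ⟨M, hM⟩ := hbound (max |a| |b|)
    refine (intervalIntegrable_const (c := M)).mono_fun hqm.aestronglyMeasurable ?_
    refine (MeasureTheory.ae_restrict_iff' measurableSet_uIoc).2 (.of_forall fun s hs => ?_)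
    refine le_trans ?_ (le_abs_self M)
    exact le_of_tendsto (hQq s).norm (hM.mono fun h hh => hh s (huIoc hs))
  have hint : ∀ t, fderiv ℝ (φ t) z u = u + ∫ s in (0 : ℝ)..t, q s := by
    intro t
    obtain ⟨M, hM⟩ := hbound (max |0| |t|)
    have h1 : Tendsto (fun h => ∫ s in (0 : ℝ)..t, Q h s) (𝓝[≠] 0) (𝓝 (∫ s in (0 : ℝ)..t, q s)) :=
      intervalIntegral.tendsto_integral_filter_of_dominated_convergence (fun _ => M)
        (.of_forall fun h => (hQc h).aestronglyMeasurable)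
        (hM.mono fun h hh => .of_forall fun s hs => hh s (huIoc hs))
        intervalIntegrable_const (.of_forall fun s _ => hQq s)
    have h2 := slope (hd t).hasFDerivAt
    refine tendsto_nhds_unique h2 ((tendsto_const_nhds.add h1).congr' ?_)
    filter_upwards [self_mem_nhdsWithin] with h hne
    have hne : h ≠ 0 := hne
    have ftc : ∀ x, ∫ s in (0 : ℝ)..t, X (φ s x) = φ t x - x := fun x => by
      rw [intervalIntegral.integral_eq_sub_of_hasDerivAt (fun s _ => hφ s x)
        ((hXc x).intervalIntegrable _ _), hφ0]
    rw [hQ, intervalIntegral.integral_smul, intervalIntegral.integral_sub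
      ((hXc _).intervalIntegrable _ _)
      ((hXc _).intervalIntegrable _ _), ftc, ftc]
    rw [show φ t (z + h • u) - (z + h • u) - (φ t z - z) = φ t (z + h • u) - φ t z - h • u by abel,
      smul_sub, inv_smul_smul₀ hne]
    abel
  have hVc : Continuous fun s => fderiv ℝ (φ s) z u := by
    simp_rw [hint]
    exact continuous_const.add (intervalIntegral.continuous_primitive hqi 0)
  have hqc : Continuous q :=
    ((hX.continuous_fderiv one_ne_zero).comp (hc z)).clm_apply hVc
  have : (fun s => fderiv ℝ (φ s) z u) = fun t => u + ∫ s in (0 : ℝ)..t, q s := funext hint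
  rw [this]
  exact (hqc.integral_hasStrictDerivAt 0 t).hasDerivAt.const_add u

/-- The operator form of the variational equation. -/
theorem hasDerivAt_fderiv_flow_clm {F : Type*} [NormedAddCommGroup F] [NormedSpace ℝ F]
    [FiniteDimensional ℝ F] {X : F → F} (hX : ContDiff ℝ 1 X) {φ : ℝ → F → F}
    (hφ0 : ∀ x, φ 0 x = x) (hφ : ∀ t x, HasDerivAt (fun s => φ s x) (X (φ t x)) t)
    {z : F} (hd : ∀ t, DifferentiableAt ℝ (φ t) z) (t : ℝ) :
    HasDerivAt (fun s => fderiv ℝ (φ s) z) (fderiv ℝ X (φ t z) ∘L fderiv ℝ (φ t) z) t := by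
  have hvar := hasDerivAt_fderiv_flow hX hφ0 hφ hd
  have hUc : Continuous fun s => fderiv ℝ (φ s) z := continuous_clm_apply.2 fun u =>
    continuous_iff_continuousAt.2 fun t => (hvar u t).continuousAt
  have hAc : Continuous fun s => fderiv ℝ X (φ s z) := (hX.continuous_fderiv one_ne_zero).comp
    (continuous_iff_continuousAt.2 fun t => (hφ t z).continuousAt)
  have hAU : Continuous fun s => fderiv ℝ X (φ s z) ∘L fderiv ℝ (φ s) z := hAc.clm_comp hUc
  have hint : (fun s => fderiv ℝ (φ s) z) = fun s => fderiv ℝ (φ 0) z +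
      ∫ r in (0 : ℝ)..s, fderiv ℝ X (φ r z) ∘L fderiv ℝ (φ r) z := by
    funext s
    ext1 u
    rw [add_apply,
      ContinuousLinearMap.intervalIntegral_apply (hAU.intervalIntegrable _ _)]
    simp only [ContinuousLinearMap.comp_apply]
    rw [intervalIntegral.integral_eq_sub_of_hasDerivAt (fun r _ => hvar u r)
      ((hAU.clm_apply continuous_const).intervalIntegrable _ _)]
    abel
  rw [hint]
  exact (hAU.integral_hasStrictDerivAt 0 t).hasDerivAt.const_add _

/-- The derivative of the tangent map `(x, v) ↦ (f x, Df(x) v)` of a `C²` map. -/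
theorem hasFDerivAt_tangent {F G : Type*} [NormedAddCommGroup F] [NormedSpace ℝ F]
    [NormedAddCommGroup G] [NormedSpace ℝ G] {f : F → G} (hf : ContDiff ℝ 2 f) (z : F × F) :
    HasFDerivAt (fun y : F × F => (f y.1, fderiv ℝ f y.1 y.2))
      ((fderiv ℝ f z.1 ∘L ContinuousLinearMap.fst ℝ F F).prod
        (fderiv ℝ f z.1 ∘L ContinuousLinearMap.snd ℝ F F +
          (fderiv ℝ (fderiv ℝ f) z.1 ∘L ContinuousLinearMap.fst ℝ F F).flip z.2)) z := by
  have h1 : HasFDerivAt f (fderiv ℝ f z.1) z.1 :=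
    (hf.differentiable two_ne_zero _).hasFDerivAt
  have h2 : HasFDerivAt (fderiv ℝ f) (fderiv ℝ (fderiv ℝ f) z.1) z.1 :=
    ((hf.fderiv_right (m := 1) (by norm_num)).differentiable one_ne_zero _).hasFDerivAt
  exact (h1.comp z hasFDerivAt_fst).prodMk ((h2.comp z hasFDerivAt_fst).clm_apply hasFDerivAt_snd)

/-- The second variational equation along a flow whose time-`t` maps are `C²`. -/
theorem hasDerivAt_fderiv_fderiv_flow {F : Type*} [NormedAddCommGroup F] [NormedSpace ℝ F]
    [FiniteDimensional ℝ F] {X : F → F} (hX : ContDiff ℝ 2 X) {φ : ℝ → F → F}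
    (hφ0 : ∀ x, φ 0 x = x) (hφ : ∀ t x, HasDerivAt (fun s => φ s x) (X (φ t x)) t)
    (hφ2 : ∀ t, ContDiff ℝ 2 (φ t)) (x v w : F) (t : ℝ) :
    HasDerivAt (fun s => fderiv ℝ (fderiv ℝ (φ s)) x v w)
      (fderiv ℝ X (φ t x) (fderiv ℝ (fderiv ℝ (φ t)) x v w) +
        fderiv ℝ (fderiv ℝ X) (φ t x) (fderiv ℝ (φ t) x v) (fderiv ℝ (φ t) x w)) t := by
  have hX1 : ContDiff ℝ 1 X := hX.of_le (by norm_num)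
  have hTX : ContDiff ℝ 1 fun y : F × F => (X y.1, fderiv ℝ X y.1 y.2) :=
    (hX1.comp contDiff_fst).prodMk
      (((hX.fderiv_right (m := 1) (by norm_num)).comp contDiff_fst).clm_apply contDiff_snd)
  have h := hasDerivAt_fderiv_flow hTX
    (φ := fun t y => (φ t y.1, fderiv ℝ (φ t) y.1 y.2)) (z := (x, w))
    (fun y => by simp [show φ 0 = id from funext hφ0])
    (fun t y => (hφ t y.1).prodMk (hasDerivAt_fderiv_flow hX1 hφ0 hφ
      (fun t => (hφ2 t).differentiable two_ne_zero _) y.2 t))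
    (fun t => (hasFDerivAt_tangent (hφ2 t) _).differentiableAt) (v, 0) t
  simp only [(hasFDerivAt_tangent (hφ2 _) _).fderiv, (hasFDerivAt_tangent hX _).fderiv] at h
  simpa [Function.comp_def] using hasFDerivAt_snd.comp_hasDerivAt t h

theorem stmt6 (p : ℕ) (ξ : EuclideanSpace ℝ (Fin p) → EuclideanSpace ℝ (Fin p))
    (hξ : ContDiff ℝ 2 ξ)
    (φ : ℝ → EuclideanSpace ℝ (Fin p) → EuclideanSpace ℝ (Fin p))
    (hφ0 : ∀ x, φ 0 x = x)
    (hφ : ∀ t x, HasDerivAt (fun s => φ s x) (ξ (φ t x)) t)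
    (hφC2 : ∀ t, ContDiff ℝ 2 (φ t))
    (x₀ : EuclideanSpace ℝ (Fin p)) (δ : ℝ) (hδ : 0 < δ)
    (v w : EuclideanSpace ℝ (Fin p)) :
    fderiv ℝ (fderiv ℝ (φ δ)) x₀ v w =
      ∫ t in (0:ℝ)..δ,
        fderiv ℝ (φ (δ - t)) (φ t x₀)
          (fderiv ℝ (fderiv ℝ ξ) (φ t x₀) (fderiv ℝ (φ t) x₀ v)
            (fderiv ℝ (φ t) x₀ w)) := by
  have hξ1 : ContDiff ℝ 1 ξ := hξ.of_le (by norm_num)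
  have hd : ∀ t, Differentiable ℝ (φ t) := fun t => (hφC2 t).differentiable two_ne_zero
  have hchain : ∀ s t x, fderiv ℝ (φ s) (φ t x) ∘L fderiv ℝ (φ t) x = fderiv ℝ (φ (s + t)) x := by
    intro s t x
    rw [← fderiv_comp x (hd s _) (hd t _)]
    exact congrArg (fderiv ℝ · x) (funext (flow_add hξ1 hφ0 hφ s t))
  have hφid : φ 0 = id := funext hφ0
  let U : ℝ → (EuclideanSpace ℝ (Fin p) →L[ℝ] EuclideanSpace ℝ (Fin p))ˣ := fun t =>
    { val := fderiv ℝ (φ t) x₀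
      inv := fderiv ℝ (φ (-t)) (φ t x₀)
      val_inv := by
        have h := hchain t (-t) (φ t x₀)
        rw [flow_add hξ1 hφ0 hφ] at h
        simpa [hφid, ContinuousLinearMap.mul_def, ContinuousLinearMap.one_def] using h
      inv_val := by
        simpa [hφid, ContinuousLinearMap.mul_def, ContinuousLinearMap.one_def]
          using hchain (-t) t x₀ }
  let b : ℝ → EuclideanSpace ℝ (Fin p) := fun t =>
    fderiv ℝ (fderiv ℝ ξ) (φ t x₀) (fderiv ℝ (φ t) x₀ v) (fderiv ℝ (φ t) x₀ w)
  have hU : ∀ t, HasDerivAt (fun s => fderiv ℝ (φ s) x₀)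
      (fderiv ℝ ξ (φ t x₀) ∘L fderiv ℝ (φ t) x₀) t :=
    hasDerivAt_fderiv_flow_clm hξ1 hφ0 hφ fun t => hd t _
  have hN : ∀ t, HasDerivAt (fun s => fderiv ℝ (φ (-s)) (φ s x₀))
      (-(fderiv ℝ (φ (-t)) (φ t x₀) ∘L fderiv ℝ ξ (φ t x₀))) t := by
    intro t
    have h := (hasFDerivAt_ringInverse (𝕜 := ℝ) (U t)).comp_hasDerivAt t (hU t)
    have e1 : (Ring.inverse ∘ fun s => fderiv ℝ (φ s) x₀) = fun s => fderiv ℝ (φ (-s)) (φ s x₀) :=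
      funext fun s => Ring.inverse_unit (U s)
    rw [e1] at h
    refine h.congr_deriv ?_
    change -((U t).inv * (fderiv ℝ ξ (φ t x₀) * (U t).val) * (U t).inv) = _
    rw [mul_assoc, mul_assoc, (U t).val_inv, mul_one]
    rfl
  have hNZ : ∀ t, HasDerivAt
      (fun s => fderiv ℝ (φ (-s)) (φ s x₀) (fderiv ℝ (fderiv ℝ (φ s)) x₀ v w))
      (fderiv ℝ (φ (-t)) (φ t x₀) (b t)) t := by
    intro t
    have h := (hN t).clm_apply (hasDerivAt_fderiv_fderiv_flow hξ hφ0 hφ hφC2 x₀ v w t)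
    simpa using h
  have hφc : Continuous fun t => φ t x₀ :=
    continuous_iff_continuousAt.2 fun t => (hφ t x₀).continuousAt
  have hUc : Continuous fun t => fderiv ℝ (φ t) x₀ :=
    continuous_iff_continuousAt.2 fun t => (hU t).continuousAt
  have hNc : Continuous fun t => fderiv ℝ (φ (-t)) (φ t x₀) :=
    continuous_iff_continuousAt.2 fun t => (hN t).continuousAt
  have hbc : Continuous b := by
    have h2 : Continuous (fderiv ℝ (fderiv ℝ ξ)) :=
      (hξ.fderiv_right (m := 1) (by norm_num)).continuous_fderiv one_ne_zero
    exact ((h2.comp hφc).clm_apply (hUc.clm_apply continuous_const)).clm_apply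
      (hUc.clm_apply continuous_const)
  have hNb : Continuous fun t => fderiv ℝ (φ (-t)) (φ t x₀) (b t) := hNc.clm_apply hbc
  have hduhamel : ∫ t in (0 : ℝ)..δ, fderiv ℝ (φ (-t)) (φ t x₀) (b t) =
      fderiv ℝ (φ (-δ)) (φ δ x₀) (fderiv ℝ (fderiv ℝ (φ δ)) x₀ v w) := by
    rw [intervalIntegral.integral_eq_sub_of_hasDerivAt (fun t _ => hNZ t)
      (hNb.intervalIntegrable _ _)]
    have h0 : fderiv ℝ (id : EuclideanSpace ℝ (Fin p) → _) = fun _ => .id ℝ _ :=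
      funext fun _ => fderiv_id
    simp [hφid, h0]
  have htransition : ∀ t, fderiv ℝ (φ (δ - t)) (φ t x₀) =
      fderiv ℝ (φ δ) x₀ ∘L fderiv ℝ (φ (-t)) (φ t x₀) := by
    intro t
    have h := hchain δ (-t) (φ t x₀)
    rw [flow_add hξ1 hφ0 hφ, neg_add_cancel, hφ0, ← sub_eq_add_neg] at h
    exact h.symm
  simp_rw [htransition, ContinuousLinearMap.comp_apply]
  rw [ContinuousLinearMap.intervalIntegral_comp_comm _ (hNb.intervalIntegrable _ _), hduhamel]
  exact (DFunLike.congr_fun (U δ).val_inv _).symm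
end

section
/- On a probability space, let X be an ℝᵖ-valued random vector whose law is multivariate Gaussian with mean μ and covariance matrix Σ (symmetric positive semidefinite), and let V be an ℝ^q-valued random vector whose law is centered multivariate Gaussian with covariance B, where B is symmetric positive definite, with X and V independent. Let J be a real q×p matrix, set Y := JX + V and G := ΣJᵀ(JΣJᵀ + B)⁻¹ (well defined since JΣJᵀ + B is positive definite). Then the conditional expectation of X given the σ-algebra generated by Y equals μ + G(Y − Jμ) almost surely. -/
open MeasureTheory ProbabilityTheory Matrix

/-- The standard Gaussian measure on `ℝⁿ` (product of standard real Gaussians). -/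
noncomputable def stdGaussianPi (n : ℕ) : Measure (Fin n → ℝ) :=
  Measure.pi fun _ => gaussianReal 0 1

/-- `X` has multivariate Gaussian law with mean `μ` and covariance `S`: its law is the
pushforward of the standard Gaussian measure under an affine map realizing `(μ, S)`. -/
def HasGaussianLaw {Ω : Type*} [MeasurableSpace Ω] (P : Measure Ω) {n : ℕ}
    (X : Ω → Fin n → ℝ) (μ : Fin n → ℝ) (S : Matrix (Fin n) (Fin n) ℝ) : Prop :=
  ∃ A : Matrix (Fin n) (Fin n) ℝ, A * Aᵀ = S ∧
    Measure.map X P = Measure.map (fun z => μ + A.mulVec z) (stdGaussianPi n)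

instance isGaussian_stdGaussianPi (n : ℕ) : IsGaussian (stdGaussianPi n) := by
  have h := (iIndepFun_pi (μ := fun _ : Fin n => gaussianReal 0 1) (X := fun _ => id)
    fun _ => aemeasurable_id).hasGaussianLaw fun i => ⟨by
      rw [show (fun ω : Fin n → ℝ => id (ω i)) = Function.eval i from rfl,
        (measurePreserving_eval _ i).map_eq]
      infer_instance⟩
  simpa using! h.isGaussian_map

theorem memLp_eval_stdGaussianPi {n : ℕ} (i : Fin n) :
    MemLp (fun z : Fin n → ℝ => z i) 2 (stdGaussianPi n) :=
  (IsGaussian.hasGaussianLaw_id (μ := stdGaussianPi n)).eval i |>.memLp_two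

theorem integral_eval_stdGaussianPi {n : ℕ} (i : Fin n) :
    ∫ z, z i ∂stdGaussianPi n = 0 := by
  simp [stdGaussianPi, integral_eval]

theorem covariance_eval_stdGaussianPi {n : ℕ} (i j : Fin n) :
    cov[fun z : Fin n → ℝ => z i, fun z => z j; stdGaussianPi n] =
      (1 : Matrix (Fin n) (Fin n) ℝ) i j := by
  rcases eq_or_ne i j with rfl | hij
  · rw [covariance_self (measurable_pi_apply i).aemeasurable, one_apply_eq]
    have h := variance_map (μ := stdGaussianPi n) (X := id) (Y := fun z : Fin n → ℝ => z i)
      aemeasurable_id (measurable_pi_apply i).aemeasurable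
    rw [stdGaussianPi, (measurePreserving_eval _ i).map_eq, variance_id_gaussianReal,
      NNReal.coe_one] at h
    exact h.symm
  · rw [one_apply_ne hij]
    exact ((iIndepFun_pi (μ := fun _ : Fin n => gaussianReal 0 1) (X := fun _ => id)
      fun _ => aemeasurable_id).indepFun hij).covariance_eq_zero (memLp_eval_stdGaussianPi i)
      (memLp_eval_stdGaussianPi j)

theorem covariance_mulVec {Ω : Type*} [MeasurableSpace Ω] {P : Measure Ω} [IsProbabilityMeasure P]
    {a b c d : Type*} [Fintype b] [Fintype d] {X : Ω → b → ℝ} {Y : Ω → d → ℝ}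
    (hX : ∀ i, MemLp (fun ω => X ω i) 2 P) (hY : ∀ j, MemLp (fun ω => Y ω j) 2 P)
    (M : Matrix a b ℝ) (N : Matrix c d ℝ) (i : a) (j : c) :
    cov[fun ω => (M *ᵥ X ω) i, fun ω => (N *ᵥ Y ω) j; P] =
      (M * (Matrix.of fun k l => cov[fun ω => X ω k, fun ω => Y ω l; P]) * Nᵀ) i j := by
  simp only [mulVec, dotProduct]
  rw [covariance_fun_sum_fun_sum (fun k => (hX k).const_mul _) (fun l => (hY l).const_mul _)]
  simp only [covariance_const_mul_left, covariance_const_mul_right, mul_apply, transpose_apply,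
    of_apply, Finset.sum_mul]
  rw [Finset.sum_comm]
  refine Finset.sum_congr rfl fun l _ => Finset.sum_congr rfl fun k _ => by ring

theorem memLp_mulVec {Ω : Type*} [MeasurableSpace Ω] {P : Measure Ω}
    {a b : Type*} [Fintype b] {X : Ω → b → ℝ}
    (hX : ∀ i, MemLp (fun ω => X ω i) 2 P) (M : Matrix a b ℝ) (i : a) :
    MemLp (fun ω => (M *ᵥ X ω) i) 2 P := by
  simp only [mulVec, dotProduct]
  exact memLp_finsetSum _ fun k _ => (hX k).const_mul _

theorem integral_mulVec {Ω : Type*} [MeasurableSpace Ω] {P : Measure Ω}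
    {a b : Type*} [Fintype b] {X : Ω → b → ℝ}
    (hX : ∀ i, Integrable (fun ω => X ω i) P) (M : Matrix a b ℝ) (i : a) :
    ∫ ω, (M *ᵥ X ω) i ∂P = (M *ᵥ fun k => ∫ ω, X ω k ∂P) i := by
  simp only [mulVec, dotProduct]
  rw [integral_finsetSum _ fun k _ => (hX k).const_mul _]
  simp only [integral_const_mul]

namespace HasGaussianLaw

variable {Ω : Type*} [MeasurableSpace Ω] {P : Measure Ω} {n : ℕ} {X : Ω → Fin n → ℝ}
  {μ : Fin n → ℝ} {S : Matrix (Fin n) (Fin n) ℝ}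

theorem hasGaussianLaw (h : HasGaussianLaw P X μ S) : ProbabilityTheory.HasGaussianLaw X P := by
  obtain ⟨A, -, hA⟩ := h
  refine ⟨?_⟩
  have hmap : Measure.map (fun z => μ + A.mulVec z) (stdGaussianPi n) =
      ((stdGaussianPi n).map (LinearMap.toContinuousLinearMap A.mulVecLin)).map
        (fun z => μ + z) := by
    rw [Measure.map_map (by fun_prop) (by fun_prop)]
    rfl
  rw [hA, hmap]
  infer_instance

theorem integral_eval (h : HasGaussianLaw P X μ S) (hX : Measurable X) (i : Fin n) :
    ∫ ω, X ω i ∂P = μ i := by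
  obtain ⟨A, -, hA⟩ := h
  have hm : Measurable fun z : Fin n → ℝ => μ + A *ᵥ z := by fun_prop
  rw [← integral_map (φ := X) (f := fun x => x i) hX.aemeasurable
    (measurable_pi_apply i).aestronglyMeasurable, hA,
    integral_map hm.aemeasurable (measurable_pi_apply i).aestronglyMeasurable]
  simp only [Pi.add_apply]
  rw [integral_add (integrable_const _)
    ((memLp_mulVec memLp_eval_stdGaussianPi A i).integrable one_le_two),
    integral_mulVec fun k => (memLp_eval_stdGaussianPi k).integrable one_le_two]
  simp [integral_eval_stdGaussianPi, mulVec, dotProduct]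

theorem covariance_eval (h : HasGaussianLaw P X μ S) (hX : Measurable X) (i j : Fin n) :
    cov[fun ω => X ω i, fun ω => X ω j; P] = S i j := by
  obtain ⟨A, rfl, hA⟩ := h
  have hm : Measurable fun z : Fin n → ℝ => μ + A *ᵥ z := by fun_prop
  rw [← covariance_map_fun (X := fun x : Fin n → ℝ => x i) (Y := fun x : Fin n → ℝ => x j)
    (measurable_pi_apply i).aestronglyMeasurable (measurable_pi_apply j).aestronglyMeasurable
    hX.aemeasurable, hA, covariance_map_fun (measurable_pi_apply i).aestronglyMeasurable
    (measurable_pi_apply j).aestronglyMeasurable hm.aemeasurable]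
  have hint := fun k => (memLp_mulVec memLp_eval_stdGaussianPi A k).integrable one_le_two
  simp only [Pi.add_apply]
  rw [covariance_const_add_left (hint i), covariance_const_add_right (hint j),
    covariance_mulVec memLp_eval_stdGaussianPi memLp_eval_stdGaussianPi]
  simp only [covariance_eval_stdGaussianPi]
  change (A * (1 : Matrix (Fin n) (Fin n) ℝ) * Aᵀ) i j = _
  rw [Matrix.mul_one]

end HasGaussianLaw

theorem stmt8 {Ω : Type*} [MeasurableSpace Ω] (P : Measure Ω) [IsProbabilityMeasure P]
    (p q : ℕ) (X : Ω → Fin p → ℝ) (V : Ω → Fin q → ℝ)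
    (hXm : Measurable X) (hVm : Measurable V)
    (μ : Fin p → ℝ) (S : Matrix (Fin p) (Fin p) ℝ) (hS : S.PosSemidef)
    (B : Matrix (Fin q) (Fin q) ℝ) (hB : B.PosDef)
    (hX : HasGaussianLaw P X μ S)
    (hV : HasGaussianLaw P V 0 B)
    (hXV : IndepFun X V P)
    (J : Matrix (Fin q) (Fin p) ℝ) :
    let Y : Ω → Fin q → ℝ := fun ω => J.mulVec (X ω) + V ω
    let G : Matrix (Fin p) (Fin q) ℝ := S * Jᵀ * (J * S * Jᵀ + B)⁻¹
    ∀ i : Fin p,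
      P[(fun ω => X ω i) | MeasurableSpace.comap Y inferInstance]
        =ᵐ[P] fun ω => μ i + G.mulVec (Y ω - J.mulVec μ) i := by
  intro Y G i
  have hXG := hX.hasGaussianLaw
  have hVG := hV.hasGaussianLaw
  have hX2 : ∀ k, MemLp (fun ω => X ω k) 2 P := fun k => (hXG.eval k).memLp_two
  have hV2 : ∀ k, MemLp (fun ω => V ω k) 2 P := fun k => (hVG.eval k).memLp_two
  have hYm : Measurable Y := by fun_prop
  have hJX2 := memLp_mulVec hX2 J
  have hY2 : ∀ k, MemLp (fun ω => Y ω k) 2 P := fun k => (hJX2 k).add (hV2 k)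
  have hXV0 : ∀ k l, cov[fun ω => X ω k, fun ω => V ω l; P] = 0 := fun k l =>
    (hXV.comp (measurable_pi_apply k) (measurable_pi_apply l)).covariance_eq_zero (hX2 k) (hV2 l)
  have hXX : (Matrix.of fun k l => cov[fun ω => X ω k, fun ω => X ω l; P]) = S := by
    ext k l
    exact hX.covariance_eval hXm k l
  have hXVm : (Matrix.of fun k l => cov[fun ω => X ω k, fun ω => V ω l; P]) = 0 := by
    ext k l
    exact hXV0 k l
  have hJXV : ∀ k l, cov[fun ω => (J *ᵥ X ω) k, fun ω => V ω l; P] = 0 := fun k l => by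
    simpa [hXVm] using covariance_mulVec hX2 hV2 J 1 k l
  have hXY : ∀ k l, cov[fun ω => X ω k, fun ω => Y ω l; P] = (S * Jᵀ) k l := fun k l => by
    have h := covariance_mulVec hX2 hX2 1 J k l
    simp only [one_mulVec, one_mul, hXX] at h
    exact (covariance_add_right (hX2 k) (hJX2 l) (hV2 l)).trans (by rw [h, hXV0, add_zero])
  have hYY : ∀ k l, cov[fun ω => Y ω k, fun ω => Y ω l; P] = (J * S * Jᵀ + B) k l := fun k l => by
    have h := covariance_mulVec hX2 hX2 J J k l
    rw [hXX] at h
    refine (covariance_add_left (hJX2 k) (hV2 k) (hY2 l)).trans ?_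
    refine (congrArg₂ (· + ·) (covariance_add_right (hJX2 k) (hJX2 l) (hV2 l))
      (covariance_add_right (hV2 k) (hJX2 l) (hV2 l))).trans ?_
    rw [h, hJXV, covariance_comm, hJXV, hV.covariance_eval hVm]
    simp
  have hdet : IsUnit (J * S * Jᵀ + B).det := by
    have hJ : (J * S * Jᵀ).PosSemidef := by
      simpa using hS.mul_mul_conjTranspose_same J
    exact ((hB.posSemidef_add hJ).isUnit.map Matrix.detMonoidHom)
  have hGY2 := memLp_mulVec hY2 G
  set Z : Ω → Fin p → ℝ := fun ω => X ω - G *ᵥ Y ω with hZ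
  have hZm : Measurable Z := by fun_prop
  have hZY : ∀ k l, cov[fun ω => Z ω k, fun ω => Y ω l; P] = 0 := fun k l => by
    have h := covariance_mulVec hY2 hY2 G 1 k l
    have hYYm : (Matrix.of fun k l => cov[fun ω => Y ω k, fun ω => Y ω l; P]) =
        J * S * Jᵀ + B := by
      ext k l
      exact hYY k l
    simp only [one_mulVec, transpose_one, Matrix.mul_one, hYYm] at h
    refine (covariance_sub_left (hX2 k) (hGY2 k) (hY2 l)).trans ?_
    rw [hXY, h, nonsing_inv_mul_cancel_right _ _ hdet, sub_self]
  have hjoint : ProbabilityTheory.HasGaussianLaw (fun ω => (Z ω, Y ω)) P := by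
    have hXVG := hXV.hasGaussianLaw hXG hVG
    let LY : (Fin p → ℝ) × (Fin q → ℝ) →ₗ[ℝ] Fin q → ℝ :=
      J.mulVecLin ∘ₗ LinearMap.fst ℝ _ _ + LinearMap.snd ℝ _ _
    let L : (Fin p → ℝ) × (Fin q → ℝ) →ₗ[ℝ] (Fin p → ℝ) × (Fin q → ℝ) :=
      (LinearMap.fst ℝ _ _ - G.mulVecLin ∘ₗ LY).prod LY
    exact hXVG.map_fun (LinearMap.toContinuousLinearMap L)
  have hind : IndepFun Z Y P :=
    hjoint.indepFun_of_covariance_eval (X := fun k ω => Z ω k) (Y := fun l ω => Y ω l) hZY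
  have hZint : Integrable (fun ω => Z ω i) P :=
    ((hX2 i).sub (hGY2 i)).integrable one_le_two
  have hGYint : Integrable (fun ω => (G *ᵥ Y ω) i) P := (hGY2 i).integrable one_le_two
  have hle : MeasurableSpace.comap Y inferInstance ≤ ‹MeasurableSpace Ω› := hYm.comap_le
  have hcondZ : P[fun ω => Z ω i | MeasurableSpace.comap Y inferInstance] =ᵐ[P]
      fun _ => ∫ ω, Z ω i ∂P :=
    condExp_indep_eq hZm.comap_le hle
      ((measurable_pi_apply i).comp (comap_measurable Z)).stronglyMeasurable hind
  have hcondGY : P[fun ω => (G *ᵥ Y ω) i | MeasurableSpace.comap Y inferInstance] =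
      fun ω => (G *ᵥ Y ω) i :=
    condExp_of_stronglyMeasurable hle
      ((by fun_prop : Measurable fun y => (G *ᵥ y) i).comp
        (comap_measurable Y)).stronglyMeasurable hGYint
  have hEY : (fun k => ∫ ω, Y ω k ∂P) = J *ᵥ μ := by
    ext k
    refine (integral_add ((hJX2 k).integrable one_le_two)
      ((hV2 k).integrable one_le_two)).trans ?_
    rw [integral_mulVec fun k => (hX2 k).integrable one_le_two, hV.integral_eval hVm]
    simp [hX.integral_eval hXm]
  have hEZ : ∫ ω, Z ω i ∂P = μ i - (G *ᵥ (J *ᵥ μ)) i := by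
    refine (integral_sub ((hX2 i).integrable one_le_two) hGYint).trans ?_
    rw [hX.integral_eval hXm, integral_mulVec fun k => (hY2 k).integrable one_le_two, hEY]
  have hXZ : (fun ω => X ω i) = (fun ω => Z ω i) + fun ω => (G *ᵥ Y ω) i := by
    ext ω
    simp [hZ]
  rw [hXZ]
  filter_upwards [condExp_add hZint hGYint (MeasurableSpace.comap Y inferInstance), hcondZ]
    with ω h₁ h₂
  rw [h₁, Pi.add_apply, h₂, hcondGY, hEZ, mulVec_sub, Pi.sub_apply]
  ring
end

section
/- With the same setup (X Gaussian N(μ,Σ) on ℝᵖ, V Gaussian N(0,B) on ℝ^q with B symmetric positive definite, X and V independent, Y := JX + V, G := ΣJᵀ(JΣJᵀ + B)⁻¹), the residual random vector X − μ − G(Y − Jμ) is independent of Y, and its law is centered multivariate Gaussian with covariance matrix (I − GJ)Σ = Σ − ΣJᵀ(JΣJᵀ + B)⁻¹JΣ. -/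
open MeasureTheory ProbabilityTheory Matrix

open Complex in
theorem integral_cexp_dotProduct_stdGaussianPi {n : ℕ} (t : Fin n → ℝ) :
    ∫ z, cexp ((t ⬝ᵥ z : ℝ) * I) ∂stdGaussianPi n = cexp (-(t ⬝ᵥ t : ℝ) / 2) := by
  have h_coord (i : Fin n) :
      ∫ x : ℝ, cexp ((t i * x : ℝ) * I) ∂gaussianReal 0 1 = cexp (-(t i * t i : ℝ) / 2) := by
    have h := charFun_gaussianReal (μ := 0) (v := 1) (t i)
    rw [charFun_apply_real] at h
    push_cast
    rw [h]
    congr 1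
    push_cast
    ring
  simp_rw [dotProduct, ofReal_sum, Finset.sum_mul, exp_sum, stdGaussianPi]
  rw [integral_fintype_prod_eq_prod (fun i (x : ℝ) => cexp ((t i * x : ℝ) * I))]
  simp_rw [h_coord]
  rw [← exp_sum, ← Finset.sum_div, Finset.sum_neg_distrib]

open Complex in
theorem integral_cexp_dotProduct_affine_stdGaussianPi {n : ℕ} (μ : Fin n → ℝ)
    (A : Matrix (Fin n) (Fin n) ℝ) (t : Fin n → ℝ) :
    ∫ x, cexp ((t ⬝ᵥ x : ℝ) * I) ∂Measure.map (fun z => μ + A *ᵥ z) (stdGaussianPi n) =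
      cexp ((t ⬝ᵥ μ : ℝ) * I - (t ⬝ᵥ (A * Aᵀ) *ᵥ t : ℝ) / 2) := by
  rw [integral_map (by fun_prop) (by fun_prop)]
  simp_rw [dotProduct_add, dotProduct_mulVec t A, ofReal_add, add_mul, Complex.exp_add]
  rw [integral_const_mul, integral_cexp_dotProduct_stdGaussianPi, ← Complex.exp_add,
    ← mulVec_mulVec, dotProduct_mulVec t A, mulVec_transpose, neg_div, sub_eq_add_neg]

instance (n : ℕ) : IsProbabilityMeasure (stdGaussianPi n) := by
  unfold stdGaussianPi
  infer_instance

open Complex in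
theorem HasGaussianLaw.integral_cexp_dotProduct {Ω : Type*} [MeasurableSpace Ω] {P : Measure Ω}
    {n : ℕ} {X : Ω → Fin n → ℝ} {μ : Fin n → ℝ} {S : Matrix (Fin n) (Fin n) ℝ}
    (hX : HasGaussianLaw P X μ S) (hXm : Measurable X) (t : Fin n → ℝ) :
    ∫ ω, cexp ((t ⬝ᵥ X ω : ℝ) * I) ∂P =
      cexp ((t ⬝ᵥ μ : ℝ) * I - (t ⬝ᵥ S *ᵥ t : ℝ) / 2) := by
  obtain ⟨A, rfl, hA⟩ := hX
  rw [← integral_cexp_dotProduct_affine_stdGaussianPi, ← hA,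
    integral_map hXm.aemeasurable (by fun_prop)]

theorem ContinuousLinearMap.exists_eq_dotProduct {n : ℕ} (L : StrongDual ℝ (Fin n → ℝ)) :
    ∃ t : Fin n → ℝ, ∀ x, L x = t ⬝ᵥ x := by
  refine ⟨fun i => L (Pi.single i 1), fun x => ?_⟩
  conv_lhs => rw [← Finset.univ_sum_single x, map_sum]
  refine Finset.sum_congr rfl fun i _ => ?_
  rw [mul_comm, ← smul_eq_mul, ← map_smul, ← Pi.single_smul, smul_eq_mul, mul_one]

open Complex in
theorem hasGaussianLaw_of_integral_cexp_dotProduct {Ω : Type*} [MeasurableSpace Ω]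
    {P : Measure Ω} [IsProbabilityMeasure P] {n : ℕ} {X : Ω → Fin n → ℝ} (hXm : Measurable X)
    {μ : Fin n → ℝ} {S : Matrix (Fin n) (Fin n) ℝ} (hS : S.PosSemidef)
    (h : ∀ t, ∫ ω, cexp ((t ⬝ᵥ X ω : ℝ) * I) ∂P =
      cexp ((t ⬝ᵥ μ : ℝ) * I - (t ⬝ᵥ S *ᵥ t : ℝ) / 2)) :
    HasGaussianLaw P X μ S := by
  obtain ⟨A, rfl⟩ : ∃ A : Matrix (Fin n) (Fin n) ℝ, S = A * Aᵀ := by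
    open scoped MatrixOrder Matrix.Norms.L2Operator in
    exact CStarAlgebra.nonneg_iff_eq_mul_star_self.mp hS.nonneg
  have := Measure.isProbabilityMeasure_map (μ := P) hXm.aemeasurable
  have := Measure.isProbabilityMeasure_map (μ := stdGaussianPi n)
    (f := fun z => μ + A *ᵥ z) (by fun_prop)
  refine ⟨A, rfl, Measure.ext_of_charFunDual (funext fun L => ?_)⟩
  obtain ⟨t, ht⟩ := L.exists_eq_dotProduct
  simp_rw [charFunDual_apply, ht]
  rw [integral_map hXm.aemeasurable (by fun_prop), h,
    integral_cexp_dotProduct_affine_stdGaussianPi]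

open Complex in
theorem indepFun_of_integral_cexp_dotProduct {Ω : Type*} [MeasurableSpace Ω]
    {P : Measure Ω} [IsProbabilityMeasure P] {m n : ℕ} {X : Ω → Fin m → ℝ} {Y : Ω → Fin n → ℝ}
    (hXm : Measurable X) (hYm : Measurable Y)
    (h : ∀ s t, ∫ ω, cexp ((s ⬝ᵥ X ω + t ⬝ᵥ Y ω : ℝ) * I) ∂P =
      (∫ ω, cexp ((s ⬝ᵥ X ω : ℝ) * I) ∂P) * ∫ ω, cexp ((t ⬝ᵥ Y ω : ℝ) * I) ∂P) :
    IndepFun X Y P := by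
  rw [indepFun_iff_charFunDual_prod hXm.aemeasurable hYm.aemeasurable]
  intro L
  obtain ⟨s, hs⟩ := (L.comp (.inl ℝ _ _)).exists_eq_dotProduct
  obtain ⟨t, ht⟩ := (L.comp (.inr ℝ _ _)).exists_eq_dotProduct
  simp_rw [charFunDual_apply, ← L.comp_inl_add_comp_inr, hs, ht]
  rw [integral_map (hXm.prodMk hYm).aemeasurable (by fun_prop),
    integral_map hXm.aemeasurable (by fun_prop), integral_map hYm.aemeasurable (by fun_prop)]
  exact h s t

open Complex in
theorem HasGaussianLaw.integral_cexp_dotProduct_add {Ω : Type*} [MeasurableSpace Ω]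
    {P : Measure Ω} {m n : ℕ} {X : Ω → Fin m → ℝ} {V : Ω → Fin n → ℝ}
    {μ : Fin m → ℝ} {ν : Fin n → ℝ} {S : Matrix (Fin m) (Fin m) ℝ} {B : Matrix (Fin n) (Fin n) ℝ}
    (hX : HasGaussianLaw P X μ S) (hV : HasGaussianLaw P V ν B)
    (hXm : Measurable X) (hVm : Measurable V) (hXV : IndepFun X V P)
    (a : Fin m → ℝ) (b : Fin n → ℝ) :
    ∫ ω, cexp ((a ⬝ᵥ X ω + b ⬝ᵥ V ω : ℝ) * I) ∂P =
      cexp ((a ⬝ᵥ μ + b ⬝ᵥ ν : ℝ) * I - (a ⬝ᵥ S *ᵥ a + b ⬝ᵥ B *ᵥ b : ℝ) / 2) := by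
  simp_rw [ofReal_add, add_mul, Complex.exp_add]
  rw [hXV.integral_fun_comp_mul_comp (f := fun x => cexp ((a ⬝ᵥ x : ℝ) * I))
    (g := fun v => cexp ((b ⬝ᵥ v : ℝ) * I)) hXm.aemeasurable hVm.aemeasurable
    (by fun_prop) (by fun_prop), hX.integral_cexp_dotProduct hXm,
    hV.integral_cexp_dotProduct hVm, ← Complex.exp_add]
  congr 1
  ring

theorem Matrix.mulVec_transpose_dotProduct {m n : Type*} [Fintype m] [Fintype n]
    (M : Matrix m n ℝ) (s : m → ℝ) (v : n → ℝ) : (Mᵀ *ᵥ s) ⬝ᵥ v = s ⬝ᵥ M *ᵥ v := by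
  rw [mulVec_transpose, dotProduct_mulVec]

section KalmanGain

variable {p q : ℕ} {S : Matrix (Fin p) (Fin p) ℝ} {B : Matrix (Fin q) (Fin q) ℝ}
  {J : Matrix (Fin q) (Fin p) ℝ} {G : Matrix (Fin p) (Fin q) ℝ}

theorem kalmanGain_mul_innovation_cov (hS : S.PosSemidef) (hB : B.PosDef) :
    S * Jᵀ * (J * S * Jᵀ + B)⁻¹ * (J * S * Jᵀ + B) = S * Jᵀ := by
  have h : (J * S * Jᵀ + B).PosDef :=
    PosDef.posSemidef_add (hS.mul_mul_conjTranspose_same J) hB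
  rw [Matrix.mul_assoc, nonsing_inv_mul _ ((isUnit_iff_isUnit_det _).mp h.isUnit),
    Matrix.mul_one]

/-- The gain equation says that the residual is uncorrelated with the observation. -/
theorem residual_cross_cov (hG : G * (J * S * Jᵀ + B) = S * Jᵀ) :
    (1 - G * J) * S * Jᵀ = G * B := by
  rw [Matrix.mul_add] at hG
  rw [Matrix.sub_mul, Matrix.sub_mul, Matrix.one_mul, ← hG]
  simp only [Matrix.mul_assoc, add_sub_cancel_left]

theorem residual_cov_eq_joseph (hG : G * (J * S * Jᵀ + B) = S * Jᵀ) :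
    (1 - G * J) * S * (1 - G * J)ᵀ + G * B * Gᵀ = (1 - G * J) * S := by
  rw [← residual_cross_cov hG, transpose_sub, transpose_mul, transpose_one, Matrix.mul_sub,
    Matrix.mul_one]
  simp only [Matrix.mul_assoc, sub_add_cancel]

theorem residual_cov_posSemidef (hS : S.PosSemidef) (hB : B.PosSemidef)
    (hG : G * (J * S * Jᵀ + B) = S * Jᵀ) : ((1 - G * J) * S).PosSemidef := by
  rw [← residual_cov_eq_joseph hG]
  exact (hS.mul_mul_conjTranspose_same (1 - G * J)).add (hB.mul_mul_conjTranspose_same G)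

theorem residual_quadratic_form (hS : Sᵀ = S) (hB : Bᵀ = B)
    (hG : G * (J * S * Jᵀ + B) = S * Jᵀ) (s : Fin p → ℝ) (t : Fin q → ℝ) :
    ((1 - G * J)ᵀ *ᵥ s + Jᵀ *ᵥ t) ⬝ᵥ S *ᵥ ((1 - G * J)ᵀ *ᵥ s + Jᵀ *ᵥ t) +
        (t - Gᵀ *ᵥ s) ⬝ᵥ B *ᵥ (t - Gᵀ *ᵥ s) =
      s ⬝ᵥ ((1 - G * J) * S) *ᵥ s + t ⬝ᵥ (J * S * Jᵀ + B) *ᵥ t := by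
  have h_cross := residual_cross_cov hG
  have h_cross' : J * S * (1 - G * J)ᵀ = B * Gᵀ := by
    have h := congrArg transpose h_cross
    rwa [transpose_mul, transpose_mul, transpose_mul, transpose_transpose, hS, hB,
      ← Matrix.mul_assoc] at h
  conv_rhs => rw [← residual_cov_eq_joseph hG]
  simp only [mulVec_add, mulVec_sub, add_dotProduct, sub_dotProduct, dotProduct_add,
    dotProduct_sub, mulVec_transpose_dotProduct, mulVec_mulVec, add_mulVec, ← Matrix.mul_assoc,
    h_cross, h_cross']
  ring

open Complex in
theorem integral_cexp_residual_observation {Ω : Type*} [MeasurableSpace Ω] {P : Measure Ω}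
    {X : Ω → Fin p → ℝ} {V : Ω → Fin q → ℝ} (hXm : Measurable X) (hVm : Measurable V)
    {μ : Fin p → ℝ} (hS : Sᵀ = S) (hB : Bᵀ = B)
    (hX : HasGaussianLaw P X μ S) (hV : HasGaussianLaw P V 0 B) (hXV : IndepFun X V P)
    (hG : G * (J * S * Jᵀ + B) = S * Jᵀ) (s : Fin p → ℝ) (t : Fin q → ℝ) :
    ∫ ω, cexp ((s ⬝ᵥ (X ω - μ - G *ᵥ (J *ᵥ X ω + V ω - J *ᵥ μ)) +
        t ⬝ᵥ (J *ᵥ X ω + V ω) : ℝ) * I) ∂P =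
      cexp (-(s ⬝ᵥ ((1 - G * J) * S) *ᵥ s : ℝ) / 2) *
        cexp ((t ⬝ᵥ J *ᵥ μ : ℝ) * I - (t ⬝ᵥ (J * S * Jᵀ + B) *ᵥ t : ℝ) / 2) := by
  have h_split (ω : Ω) : s ⬝ᵥ (X ω - μ - G *ᵥ (J *ᵥ X ω + V ω - J *ᵥ μ)) +
      t ⬝ᵥ (J *ᵥ X ω + V ω) =
      -(s ⬝ᵥ (1 - G * J) *ᵥ μ) + (((1 - G * J)ᵀ *ᵥ s + Jᵀ *ᵥ t) ⬝ᵥ X ω +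
        (t - Gᵀ *ᵥ s) ⬝ᵥ V ω) := by
    simp only [mulVec_add, mulVec_sub, add_dotProduct, sub_dotProduct, dotProduct_add,
      dotProduct_sub, mulVec_transpose_dotProduct, mulVec_mulVec, sub_mulVec, one_mulVec]
    ring
  simp_rw [h_split]
  conv_lhs =>
    enter [2, ω]
    rw [ofReal_add, add_mul, Complex.exp_add]
  rw [integral_const_mul, hX.integral_cexp_dotProduct_add hV hXm hVm hXV,
    residual_quadratic_form hS hB hG, ← Complex.exp_add, ← Complex.exp_add]
  simp only [add_dotProduct, mulVec_transpose_dotProduct, dotProduct_zero]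
  congr 1
  push_cast
  ring

end KalmanGain

theorem stmt9 {Ω : Type*} [MeasurableSpace Ω] (P : Measure Ω) [IsProbabilityMeasure P]
    (p q : ℕ) (X : Ω → Fin p → ℝ) (V : Ω → Fin q → ℝ)
    (hXm : Measurable X) (hVm : Measurable V)
    (μ : Fin p → ℝ) (S : Matrix (Fin p) (Fin p) ℝ) (hS : S.PosSemidef)
    (B : Matrix (Fin q) (Fin q) ℝ) (hB : B.PosDef)
    (hX : HasGaussianLaw P X μ S)
    (hV : HasGaussianLaw P V 0 B)
    (hXV : IndepFun X V P)
    (J : Matrix (Fin q) (Fin p) ℝ) :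
    let Y : Ω → Fin q → ℝ := fun ω => J.mulVec (X ω) + V ω
    let G : Matrix (Fin p) (Fin q) ℝ := S * Jᵀ * (J * S * Jᵀ + B)⁻¹
    let R : Ω → Fin p → ℝ := fun ω => X ω - μ - G.mulVec (Y ω - J.mulVec μ)
    IndepFun R Y P ∧
    HasGaussianLaw P R 0 ((1 - G * J) * S) ∧
    (1 - G * J) * S = S - S * Jᵀ * (J * S * Jᵀ + B)⁻¹ * (J * S) := by
  intro Y G R
  have hG : G * (J * S * Jᵀ + B) = S * Jᵀ := kalmanGain_mul_innovation_cov hS hB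
  have hYm : Measurable Y := by fun_prop
  have hRm : Measurable R := by fun_prop
  have hS_symm : Sᵀ = S := hS.isHermitian
  have hB_symm : Bᵀ = B := hB.isHermitian
  have h_joint (s : Fin p → ℝ) (t : Fin q → ℝ) :
      ∫ ω, Complex.exp ((s ⬝ᵥ R ω + t ⬝ᵥ Y ω : ℝ) * Complex.I) ∂P =
        Complex.exp (-(s ⬝ᵥ ((1 - G * J) * S) *ᵥ s : ℝ) / 2) *
          Complex.exp ((t ⬝ᵥ J *ᵥ μ : ℝ) * Complex.I -
            (t ⬝ᵥ (J * S * Jᵀ + B) *ᵥ t : ℝ) / 2) :=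
    integral_cexp_residual_observation hXm hVm hS_symm hB_symm hX hV hXV hG s t
  have h_residual (s : Fin p → ℝ) : ∫ ω, Complex.exp ((s ⬝ᵥ R ω : ℝ) * Complex.I) ∂P =
      Complex.exp (-(s ⬝ᵥ ((1 - G * J) * S) *ᵥ s : ℝ) / 2) := by
    simpa only [zero_dotProduct, add_zero, Complex.ofReal_zero, zero_mul, sub_zero, zero_div,
      Complex.exp_zero, mul_one] using h_joint s 0
  have h_obs (t : Fin q → ℝ) : ∫ ω, Complex.exp ((t ⬝ᵥ Y ω : ℝ) * Complex.I) ∂P =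
      Complex.exp ((t ⬝ᵥ J *ᵥ μ : ℝ) * Complex.I -
        (t ⬝ᵥ (J * S * Jᵀ + B) *ᵥ t : ℝ) / 2) := by
    simpa only [zero_dotProduct, zero_add, Complex.ofReal_zero, neg_zero, zero_div,
      Complex.exp_zero, one_mul] using h_joint 0 t
  refine ⟨indepFun_of_integral_cexp_dotProduct hRm hYm fun s t => ?_,
    hasGaussianLaw_of_integral_cexp_dotProduct hRm
      (residual_cov_posSemidef hS hB.posSemidef hG) fun s => ?_, ?_⟩
  · rw [h_residual, h_obs]
    exact h_joint s t
  · rw [h_residual, dotProduct_zero, Complex.ofReal_zero, zero_mul, zero_sub, neg_div]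
  · rw [Matrix.sub_mul, Matrix.one_mul, Matrix.mul_assoc G]
end

section
/- Let Γ : ℝᵖ → L(ℝᵖ ⊗ ℝᵖ; ℝᵖ) be a C² map assigning to each point a symmetric bilinear map (a local connector). For y ∈ ℝᵖ and w ∈ ℝᵖ define v(w) := w + (1/2)Γ(y)(w⊗w) + (1/6)[DΓ(y)(w)(w⊗w) + Γ(y)(Γ(y)(w⊗w) ⊗ w)], and let γ_w : [0,1] → ℝᵖ be the solution of γ'' = −Γ(γ)(γ' ⊗ γ') with γ(0) = y, γ'(0) = v(w). Then there exist constants r > 0 and C > 0 such that for all ‖w‖ < r the solution exists on [0,1] and ‖γ_w(1) − (y + w)‖ ≤ C‖w‖⁴. -/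
section GeodesicTaylor

open Set Metric Topology

set_option maxSynthPendingDepth 3

variable {E : Type*} [NormedAddCommGroup E] [NormedSpace ℝ E]

/-- Solutions of a `C¹` autonomous equation starting near `x₀` exist for a uniform time and stay
in a prescribed neighbourhood of `x₀`. -/
theorem exists_forall_mem_closedBall_integralCurve_mem_nhds [CompleteSpace E] {f : E → E} {x₀ : E}
    (hf : ContDiffAt ℝ 1 f x₀) {U : Set E} (hU : U ∈ 𝓝 x₀) :
    ∃ r > (0 : ℝ), ∃ ε > (0 : ℝ), ∀ x ∈ closedBall x₀ r, ∃ α : ℝ → E, α 0 = x ∧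
      ∀ t ∈ Ioo (-ε) ε, HasDerivAt α (f (α t)) t ∧ α t ∈ U := by
  obtain ⟨ε, hε, a, r, _, _, hr, hpl⟩ := IsPicardLindelof.of_contDiffAt_one hf
  obtain ⟨α, hα, hcont⟩ :=
    (hpl 0).exists_forall_mem_closedBall_eq_hasDerivWithinAt_continuousOn
  simp only [zero_sub, zero_add] at hα hcont
  have hr' : (0 : ℝ) < r := hr
  have hx₀ := (hα x₀ (mem_closedBall_self hr'.le)).1
  have hnhds : closedBall x₀ (r : ℝ) ×ˢ Icc (-ε) ε ∈ 𝓝 (x₀, (0 : ℝ)) :=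
    prod_mem_nhds (closedBall_mem_nhds x₀ hr') (Icc_mem_nhds (by linarith) hε)
  have hpre : α ⁻¹' U ∈ 𝓝 (x₀, (0 : ℝ)) :=
    (hcont.continuousAt hnhds).preimage_mem_nhds (by rwa [hx₀])
  obtain ⟨δ, hδ, hsub⟩ := Metric.mem_nhds_iff.mp hpre
  refine ⟨min r (δ / 2), by positivity, min ε δ, by positivity, fun x hx ↦ ?_⟩
  have hxr : x ∈ closedBall x₀ (r : ℝ) := closedBall_subset_closedBall (min_le_left _ _) hx
  refine ⟨fun t ↦ α (x, t), (hα x hxr).1, fun t ht ↦ ?_⟩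
  have htε : t ∈ Ioo (-ε) ε :=
    ⟨by linarith [ht.1, min_le_left ε δ], ht.2.trans_le (min_le_left _ _)⟩
  refine ⟨((hα x hxr).2 t (Ioo_subset_Icc_self htε)).hasDerivAt (Icc_mem_nhds htε.1 htε.2),
    hsub ?_⟩
  rw [← ball_prod_same]
  refine ⟨?_, ?_⟩
  · have := (mem_closedBall.mp hx).trans (min_le_right _ _)
    exact mem_ball.mpr (by linarith)
  · rw [mem_ball, Real.dist_eq, sub_zero, abs_lt]
    exact ⟨by linarith [ht.1, min_le_right ε δ], ht.2.trans_le (min_le_right _ _)⟩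

/-- Geodesics of a `C¹` connection with small initial velocity `v` exist on `[0, 1]`, stay in a
prescribed neighbourhood, and have velocity `O(‖v‖)`. -/
theorem exists_geodesic [CompleteSpace E] {Γ : E → E →L[ℝ] E →L[ℝ] E} (hΓ : ContDiff ℝ 1 Γ) (y : E)
    {U : Set E} (hU : U ∈ 𝓝 y) :
    ∃ ρ > (0 : ℝ), ∃ K > (0 : ℝ), ∀ v : E, ‖v‖ ≤ ρ → ∃ γ dγ : ℝ → E, γ 0 = y ∧ dγ 0 = v ∧
      ∀ t ∈ Icc (0 : ℝ) 1, HasDerivAt γ (dγ t) t ∧ HasDerivAt dγ (-(Γ (γ t) (dγ t) (dγ t))) t ∧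
        γ t ∈ U ∧ ‖dγ t‖ ≤ K * ‖v‖ := by
  obtain ⟨M, hM, hMU⟩ : ∃ M > (0 : ℝ), ∀ᶠ x in 𝓝 y, ‖Γ x‖ < M :=
    ⟨‖Γ y‖ + 1, by positivity,
      hΓ.continuous.norm.continuousAt.eventually_lt continuousAt_const (lt_add_one _)⟩
  have hF : ContDiff ℝ 1 fun z : E × E ↦ (z.2, -(Γ z.1 z.2 z.2)) :=
    contDiff_snd.prodMk
      (((hΓ.comp contDiff_fst).clm_apply contDiff_snd).clm_apply contDiff_snd).neg
  obtain ⟨r, hr, ε, hε, h⟩ := exists_forall_mem_closedBall_integralCurve_mem_nhds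
    (x₀ := (y, (0 : E))) hF.contDiffAt
    (prod_mem_nhds (Filter.inter_mem hU hMU) (ball_mem_nhds (0 : E) one_pos))
  set c := ε / 2 with hc
  have hc0 : 0 < c := by positivity
  refine ⟨c * r, by positivity, Real.exp (M * c), Real.exp_pos _, fun v hv ↦ ?_⟩
  obtain ⟨α, hα0, hα⟩ := h (y, c⁻¹ • v) (by
    rw [← closedBall_prod_same]
    refine ⟨mem_closedBall_self hr.le, ?_⟩
    rw [mem_closedBall_zero_iff, norm_smul, norm_inv, Real.norm_of_nonneg hc0.le,
      inv_mul_le_iff₀ hc0]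
    exact hv)
  have hmem : ∀ t ∈ Icc (0 : ℝ) 1, c * t ∈ Ioo (-ε) ε := fun t ht ↦
    ⟨by nlinarith [ht.1], by nlinarith [ht.2]⟩
  have hlin (t : ℝ) : HasDerivAt (fun s ↦ c * s) c t := by
    simpa using (hasDerivAt_id t).const_mul c
  have hγ : ∀ t ∈ Icc (0 : ℝ) 1,
      HasDerivAt (fun s ↦ (α (c * s)).1) (c • (α (c * t)).2) t := fun t ht ↦
    ((ContinuousLinearMap.fst ℝ E E).hasFDerivAt.comp_hasDerivAt _
      (hα _ (hmem t ht)).1).scomp t (hlin t)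
  have hdγ : ∀ t ∈ Icc (0 : ℝ) 1, HasDerivAt (fun s ↦ c • (α (c * s)).2)
      (-(Γ (α (c * t)).1 (c • (α (c * t)).2) (c • (α (c * t)).2))) t := fun t ht ↦ by
    have := (((ContinuousLinearMap.snd ℝ E E).hasFDerivAt.comp_hasDerivAt _
      (hα _ (hmem t ht)).1).scomp t (hlin t)).const_smul c
    refine this.congr_deriv ?_
    simp
  have hv0 : c • (α (c * 0)).2 = v := by simp [hα0, smul_smul, hc0.ne']
  refine ⟨fun s ↦ (α (c * s)).1, fun s ↦ c • (α (c * s)).2, by simp [hα0], hv0,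
    fun t ht ↦ ⟨hγ t ht, hdγ t ht, (hα _ (hmem t ht)).2.1.1, ?_⟩⟩
  have hgr := norm_le_gronwallBound_of_norm_deriv_right_le (δ := ‖v‖) (K := M * c) (ε := 0)
    (HasDerivAt.continuousOn hdγ) (fun s hs ↦ (hdγ s (Ico_subset_Icc_self hs)).hasDerivWithinAt)
    (by rw [hv0]) (fun s hs ↦ ?_) t ht
  · refine hgr.trans ?_
    rw [gronwallBound_ε0, mul_comm, sub_zero]
    exact mul_le_mul_of_nonneg_right
      (Real.exp_le_exp.mpr (mul_le_of_le_one_right (by positivity) ht.2)) (norm_nonneg v)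
  · obtain ⟨⟨-, hΓs⟩, hus⟩ := (hα _ (hmem s (Ico_subset_Icc_self hs))).2
    rw [norm_neg, add_zero]
    refine (ContinuousLinearMap.le_opNorm₂ _ _ _).trans ?_
    gcongr
    · exact le_of_lt hΓs
    · rw [norm_smul, Real.norm_of_nonneg hc0.le]
      exact mul_le_of_le_one_right hc0.le (mem_ball_zero_iff.mp hus).le

theorem norm_sub_le_of_norm_deriv_sub_le {f f' g g' : ℝ → E} {B : ℝ}
    (hf : ∀ t ∈ Icc (0 : ℝ) 1, HasDerivAt f (f' t) t)
    (hg : ∀ t ∈ Icc (0 : ℝ) 1, HasDerivAt g (g' t) t) (h0 : f 0 = g 0)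
    (hB : ∀ t ∈ Icc (0 : ℝ) 1, ‖f' t - g' t‖ ≤ B) :
    ∀ t ∈ Icc (0 : ℝ) 1, ‖f t - g t‖ ≤ B := by
  intro t ht
  have hB0 : 0 ≤ B := (norm_nonneg _).trans (hB t ht)
  have h := norm_image_sub_le_of_norm_deriv_le_segment'
    (fun s hs ↦ ((hf s hs).sub (hg s hs)).hasDerivWithinAt)
    (fun s hs ↦ hB s (Ico_subset_Icc_self hs)) t ht
  simp only [Pi.sub_apply, h0, sub_self, sub_zero] at h
  exact h.trans (mul_le_of_le_one_right hB0 ht.2)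

/-- Third-order Taylor estimate on `[0, 1]` in terms of the oscillation of the third derivative. -/
theorem norm_sub_taylor_three_le {f f₁ f₂ f₃ : ℝ → E} {B : ℝ}
    (h₀ : ∀ t ∈ Icc (0 : ℝ) 1, HasDerivAt f (f₁ t) t)
    (h₁ : ∀ t ∈ Icc (0 : ℝ) 1, HasDerivAt f₁ (f₂ t) t)
    (h₂ : ∀ t ∈ Icc (0 : ℝ) 1, HasDerivAt f₂ (f₃ t) t)
    (hB : ∀ t ∈ Icc (0 : ℝ) 1, ‖f₃ t - f₃ 0‖ ≤ B) :
    ‖f 1 - (f 0 + f₁ 0 + (1 / 2 : ℝ) • f₂ 0 + (1 / 6 : ℝ) • f₃ 0)‖ ≤ B := by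
  have hp (n : ℕ) (k : ℝ) (a : E) (t : ℝ) :
      HasDerivAt (fun s : ℝ ↦ (k * s ^ (n + 1)) • a) ((k * ((n + 1 : ℕ) * t ^ n)) • a) t := by
    simpa using ((hasDerivAt_pow (n + 1) t).const_mul k).smul_const a
  have e₂ := norm_sub_le_of_norm_deriv_sub_le h₂
    (g := fun t ↦ f₂ 0 + (1 * t ^ (0 + 1)) • f₃ 0) (g' := fun _ ↦ f₃ 0)
    (fun t _ ↦ by simpa using (hp 0 1 (f₃ 0) t).const_add (f₂ 0)) (by simp) hB
  have e₁ := norm_sub_le_of_norm_deriv_sub_le h₁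
    (g := fun t ↦ f₁ 0 + ((1 * t ^ (0 + 1)) • f₂ 0 + ((1 / 2) * t ^ (1 + 1)) • f₃ 0))
    (fun t _ ↦ by
      convert! ((hp 0 1 (f₂ 0) t).add (hp 1 (1 / 2) (f₃ 0) t)).const_add (f₁ 0) using 1
      congr 2
      · simp
      · push_cast; ring) (by simp) e₂
  have e₀ := norm_sub_le_of_norm_deriv_sub_le h₀
    (g := fun t ↦ f 0 + ((1 * t ^ (0 + 1)) • f₁ 0 +
      (((1 / 2) * t ^ (1 + 1)) • f₂ 0 + ((1 / 6) * t ^ (2 + 1)) • f₃ 0)))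
    (fun t _ ↦ by
      convert! ((hp 0 1 (f₁ 0) t).add
        ((hp 1 (1 / 2) (f₂ 0) t).add (hp 2 (1 / 6) (f₃ 0) t))).const_add (f 0) using 1
      congr 1
      · simp
      · congr 2
        · push_cast; ring
        · push_cast; ring) (by simp) e₁
  convert e₀ 1 (right_mem_Icc.2 zero_le_one) using 3
  simp [add_assoc]

/-- The third derivative of a geodesic of `Γ` at a point `x` with velocity `u`. -/
noncomputable def geodesicJerk (Γ : E → E →L[ℝ] E →L[ℝ] E) (x u : E) : E :=
  -(fderiv ℝ Γ x u u u) + Γ x (Γ x u u) u + Γ x u (Γ x u u)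

theorem hasDerivAt_geodesic_acceleration {Γ : E → E →L[ℝ] E →L[ℝ] E} (hΓ : Differentiable ℝ Γ)
    {γ dγ : ℝ → E} {t : ℝ} (hγ : HasDerivAt γ (dγ t) t)
    (hdγ : HasDerivAt dγ (-(Γ (γ t) (dγ t) (dγ t))) t) :
    HasDerivAt (fun s ↦ -(Γ (γ s) (dγ s) (dγ s))) (geodesicJerk Γ (γ t) (dγ t)) t := by
  have h := ((((hΓ (γ t)).hasFDerivAt.comp_hasDerivAt t hγ).clm_apply hdγ).clm_apply hdγ).neg
  refine h.congr_deriv ?_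
  simp only [geodesicJerk, Function.comp_apply, add_apply, map_neg,
    neg_apply]
  abel

theorem geodesicJerk_smul (Γ : E → E →L[ℝ] E →L[ℝ] E) (c : ℝ) (x u : E) :
    geodesicJerk Γ x (c • u) = c ^ 3 • geodesicJerk Γ x u := by
  simp only [geodesicJerk, map_smul, smul_apply, smul_add, smul_neg, smul_smul]
  ring_nf

theorem contDiff_geodesicJerk {Γ : E → E →L[ℝ] E →L[ℝ] E} (hΓ : ContDiff ℝ 2 Γ) :
    ContDiff ℝ 1 fun z : E × E ↦ geodesicJerk Γ z.1 z.2 := by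
  have h1 : ContDiff ℝ 1 fun z : E × E ↦ Γ z.1 := (hΓ.of_le one_le_two).comp contDiff_fst
  have hD : ContDiff ℝ 1 fun z : E × E ↦ fderiv ℝ Γ z.1 :=
    (hΓ.fderiv_right (by norm_num)).comp contDiff_fst
  have hu : ContDiff ℝ 1 fun z : E × E ↦ z.2 := contDiff_snd
  have hq := (h1.clm_apply hu).clm_apply hu
  exact ((((hD.clm_apply hu).clm_apply hu).clm_apply hu).neg.add
    ((h1.clm_apply hq).clm_apply hu)).add ((h1.clm_apply hu).clm_apply hq)

/-- Scale-invariant local Lipschitz estimate for a `C¹` map that is cubic in its second argument. -/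
theorem exists_norm_sub_le_of_homogeneous_three {F : Type*} [NormedAddCommGroup F] [NormedSpace ℝ F]
    {G : E → E → F} (hG : ∀ (c : ℝ) x u, G x (c • u) = c ^ 3 • G x u) {y : E}
    (hd : ContDiffAt ℝ 1 (fun z : E × E ↦ G z.1 z.2) (y, 0)) :
    ∃ U ∈ 𝓝 y, ∃ K > (0 : ℝ), ∀ x ∈ U, ∀ x' ∈ U, ∀ (s : ℝ) (u u' : E), ‖u‖ ≤ s → ‖u'‖ ≤ s →
      ‖G x u - G x' u'‖ ≤ K * s ^ 2 * (s * ‖x - x'‖ + ‖u - u'‖) := by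
  obtain ⟨K, V, hV, hK⟩ := hd.exists_lipschitzOnWith
  obtain ⟨δ, hδ, hsub⟩ := Metric.mem_nhds_iff.mp hV
  rw [← ball_prod_same] at hsub
  set ρ := δ / 2 with hρ
  have hρ0 : 0 < ρ := by positivity
  refine ⟨ball y δ, ball_mem_nhds y hδ, K * (1 + ρ) / ρ ^ 3 + 1, by positivity,
    fun x hx x' hx' s u u' hu hu' ↦ ?_⟩
  rcases (norm_nonneg u |>.trans hu).eq_or_lt with rfl | hs
  · have hG0 (x : E) : G x 0 = 0 := by simpa using hG 0 x 0
    rw [norm_le_zero_iff.mp hu, norm_le_zero_iff.mp hu', hG0, hG0]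
    simp
  have hrepr (x u : E) : G x u = (s / ρ) ^ 3 • G x ((ρ / s) • u) := by
    rw [← hG, smul_smul, div_mul_div_cancel₀ hρ0.ne', div_self hs.ne', one_smul]
  have hball (u : E) (hu : ‖u‖ ≤ s) : (ρ / s) • u ∈ ball (0 : E) δ := by
    rw [mem_ball_zero_iff, norm_smul, Real.norm_of_nonneg (by positivity), div_mul_eq_mul_div,
      div_lt_iff₀ hs]
    nlinarith
  have hl := hK.norm_sub_le (hsub (mk_mem_prod hx (hball u hu)))
    (hsub (mk_mem_prod hx' (hball u' hu')))
  simp only [Prod.mk_sub_mk, Prod.norm_mk, ← smul_sub, norm_smul,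
    Real.norm_of_nonneg (show 0 ≤ ρ / s by positivity)] at hl
  have hmax : max ‖x - x'‖ (ρ / s * ‖u - u'‖) ≤ (1 + ρ) / s * (s * ‖x - x'‖ + ‖u - u'‖) := by
    have e : (1 + ρ) / s * (s * ‖x - x'‖ + ‖u - u'‖) =
        ‖x - x'‖ + (ρ * ‖x - x'‖ + 1 / s * ‖u - u'‖ + ρ / s * ‖u - u'‖) := by
      field_simp; ring
    rw [e]
    apply max_le
    · exact le_add_of_nonneg_right (by positivity)
    · have : 0 ≤ ‖x - x'‖ + (ρ * ‖x - x'‖ + 1 / s * ‖u - u'‖) := by positivity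
      linarith
  rw [hrepr x u, hrepr x' u', ← smul_sub, norm_smul, Real.norm_of_nonneg (by positivity)]
  calc (s / ρ) ^ 3 * ‖G x ((ρ / s) • u) - G x' ((ρ / s) • u')‖
      ≤ (s / ρ) ^ 3 * (K * ((1 + ρ) / s * (s * ‖x - x'‖ + ‖u - u'‖))) := by
        gcongr
        exact hl.trans (by gcongr)
    _ = K * (1 + ρ) / ρ ^ 3 * s ^ 2 * (s * ‖x - x'‖ + ‖u - u'‖) := by field_simp
    _ ≤ _ := by gcongr; linarith

/-- The third-order expansion of the inverse exponential map at `y`, evaluated at `y + w`. -/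
noncomputable def invExpTaylor (Γ : E → E →L[ℝ] E →L[ℝ] E) (y w : E) : E :=
  w + (1 / 2 : ℝ) • Γ y w w + (1 / 6 : ℝ) • (fderiv ℝ Γ y w w w + Γ y (Γ y w w) w)

theorem exists_norm_invExpTaylor_sub_le (Γ : E → E →L[ℝ] E →L[ℝ] E) (y : E) :
    ∃ P ≥ (0 : ℝ), ∀ w, ‖w‖ ≤ 1 →
      ‖(1 / 6 : ℝ) • (fderiv ℝ Γ y w w w + Γ y (Γ y w w) w)‖ ≤ P * ‖w‖ ^ 3 ∧
      ‖invExpTaylor Γ y w - w‖ ≤ P * ‖w‖ ^ 2 ∧ ‖invExpTaylor Γ y w‖ ≤ (1 + P) * ‖w‖ := by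
  set M := ‖Γ y‖
  set N := ‖fderiv ℝ Γ y‖
  have hM : 0 ≤ M := norm_nonneg _
  have hN : 0 ≤ N := norm_nonneg _
  refine ⟨M + N + M ^ 2, by positivity, fun w hw ↦ ?_⟩
  have hs := norm_nonneg w
  have hq : ‖Γ y w w‖ ≤ M * ‖w‖ ^ 2 := by
    simpa [sq, mul_assoc] using (Γ y).le_opNorm₂ w w
  have hD : ‖fderiv ℝ Γ y w w w‖ ≤ N * ‖w‖ ^ 3 :=
    calc _ ≤ ‖fderiv ℝ Γ y w‖ * ‖w‖ * ‖w‖ := (fderiv ℝ Γ y w).le_opNorm₂ w w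
      _ ≤ N * ‖w‖ * ‖w‖ * ‖w‖ := by gcongr; exact (fderiv ℝ Γ y).le_opNorm w
      _ = _ := by ring
  have hB : ‖Γ y (Γ y w w) w‖ ≤ M ^ 2 * ‖w‖ ^ 3 :=
    calc _ ≤ M * ‖Γ y w w‖ * ‖w‖ := (Γ y).le_opNorm₂ _ w
      _ ≤ M * (M * ‖w‖ ^ 2) * ‖w‖ := by gcongr
      _ = _ := by ring
  have hc : ‖(1 / 6 : ℝ) • (fderiv ℝ Γ y w w w + Γ y (Γ y w w) w)‖ ≤ (N + M ^ 2) * ‖w‖ ^ 3 := by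
    rw [norm_smul, Real.norm_of_nonneg (by norm_num)]
    have h1 := norm_add_le (fderiv ℝ Γ y w w w) (Γ y (Γ y w w) w)
    have h2 := norm_nonneg (fderiv ℝ Γ y w w w + Γ y (Γ y w w) w)
    linarith
  have hsub : ‖invExpTaylor Γ y w - w‖ ≤ (M + N + M ^ 2) * ‖w‖ ^ 2 := by
    rw [invExpTaylor, add_assoc, add_sub_cancel_left]
    refine (norm_add_le _ _).trans ?_
    have h1 : ‖(1 / 2 : ℝ) • Γ y w w‖ ≤ M * ‖w‖ ^ 2 := by
      rw [norm_smul, Real.norm_of_nonneg (by norm_num)]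
      linarith [norm_nonneg (Γ y w w)]
    have h2 : (N + M ^ 2) * ‖w‖ ^ 3 ≤ (N + M ^ 2) * ‖w‖ ^ 2 := by
      gcongr ?_ * ?_
      exact pow_le_pow_of_le_one hs hw (by norm_num)
    linarith
  refine ⟨hc.trans ?_, hsub, ?_⟩
  · gcongr
    linarith
  · have h1 := norm_sub_norm_le (invExpTaylor Γ y w) w
    have h2 : (M + N + M ^ 2) * ‖w‖ ^ 2 ≤ (M + N + M ^ 2) * ‖w‖ := by
      gcongr
      exact pow_le_of_le_one hs hw (by norm_num)
    linarith

theorem taylor_three_geodesic_invExpTaylor {Γ : E → E →L[ℝ] E →L[ℝ] E}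
    (hsymm : ∀ x u v, Γ x u v = Γ x v u) (y w : E) :
    invExpTaylor Γ y w + (1 / 2 : ℝ) • -(Γ y (invExpTaylor Γ y w) (invExpTaylor Γ y w)) +
        (1 / 6 : ℝ) • geodesicJerk Γ y (invExpTaylor Γ y w) - w =
      (1 / 6 : ℝ) • (geodesicJerk Γ y (invExpTaylor Γ y w) - geodesicJerk Γ y w) -
        Γ y w ((1 / 6 : ℝ) • (fderiv ℝ Γ y w w w + Γ y (Γ y w w) w)) -
        (1 / 2 : ℝ) • Γ y (invExpTaylor Γ y w - w) (invExpTaylor Γ y w - w) := by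
  generalize hJ : geodesicJerk Γ y (invExpTaylor Γ y w) = J
  have hexp : Γ y (invExpTaylor Γ y w - w) (invExpTaylor Γ y w - w) =
      Γ y (invExpTaylor Γ y w) (invExpTaylor Γ y w) -
        (2 : ℝ) • Γ y w (invExpTaylor Γ y w) + Γ y w w := by
    simp only [map_sub, sub_apply, hsymm y (invExpTaylor Γ y w) w]
    module
  rw [hexp]
  generalize Γ y (invExpTaylor Γ y w) (invExpTaylor Γ y w) = Q
  simp only [invExpTaylor, geodesicJerk, map_add, map_smul, hsymm y w (Γ y w w)]
  module

theorem exists_norm_taylor_three_geodesic_invExpTaylor_le {Γ : E → E →L[ℝ] E →L[ℝ] E}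
    (hΓ : ContDiff ℝ 2 Γ) (hsymm : ∀ x u v, Γ x u v = Γ x v u) (y : E) :
    ∃ C ≥ (0 : ℝ), ∀ w, ‖w‖ ≤ 1 →
      ‖invExpTaylor Γ y w + (1 / 2 : ℝ) • -(Γ y (invExpTaylor Γ y w) (invExpTaylor Γ y w)) +
        (1 / 6 : ℝ) • geodesicJerk Γ y (invExpTaylor Γ y w) - w‖ ≤ C * ‖w‖ ^ 4 := by
  obtain ⟨P, hP, hw⟩ := exists_norm_invExpTaylor_sub_le Γ y
  obtain ⟨U, hU, K, hK, hlip⟩ := exists_norm_sub_le_of_homogeneous_three (geodesicJerk_smul Γ)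
    (contDiff_geodesicJerk hΓ).contDiffAt (y := y)
  refine ⟨K * (1 + P) ^ 2 * P + ‖Γ y‖ * P + ‖Γ y‖ * P ^ 2, by positivity, fun w hw1 ↦ ?_⟩
  obtain ⟨hc, hd, hv⟩ := hw w hw1
  rw [taylor_three_geodesic_invExpTaylor hsymm]
  have hyU := mem_of_mem_nhds hU
  have hJ : ‖(1 / 6 : ℝ) • (geodesicJerk Γ y (invExpTaylor Γ y w) - geodesicJerk Γ y w)‖ ≤
      K * (1 + P) ^ 2 * P * ‖w‖ ^ 4 := by
    have h := hlip y hyU y hyU ((1 + P) * ‖w‖) _ w hv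
      (le_mul_of_one_le_left (norm_nonneg w) (by linarith))
    rw [sub_self, norm_zero, mul_zero, zero_add] at h
    rw [norm_smul, Real.norm_of_nonneg (by norm_num)]
    calc _ ≤ ‖geodesicJerk Γ y (invExpTaylor Γ y w) - geodesicJerk Γ y w‖ := by
          linarith [norm_nonneg (geodesicJerk Γ y (invExpTaylor Γ y w) - geodesicJerk Γ y w)]
      _ ≤ K * ((1 + P) * ‖w‖) ^ 2 * (P * ‖w‖ ^ 2) := h.trans (by gcongr)
      _ = _ := by ring
  have hB : ‖Γ y w ((1 / 6 : ℝ) • (fderiv ℝ Γ y w w w + Γ y (Γ y w w) w))‖ ≤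
      ‖Γ y‖ * P * ‖w‖ ^ 4 :=
    calc _ ≤ ‖Γ y‖ * ‖w‖ * (P * ‖w‖ ^ 3) := ((Γ y).le_opNorm₂ _ _).trans (by gcongr)
      _ = _ := by ring
  have hQ : ‖(1 / 2 : ℝ) • Γ y (invExpTaylor Γ y w - w) (invExpTaylor Γ y w - w)‖ ≤
      ‖Γ y‖ * P ^ 2 * ‖w‖ ^ 4 := by
    rw [norm_smul, Real.norm_of_nonneg (by norm_num)]
    calc _ ≤ ‖Γ y (invExpTaylor Γ y w - w) (invExpTaylor Γ y w - w)‖ := by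
          linarith [norm_nonneg (Γ y (invExpTaylor Γ y w - w) (invExpTaylor Γ y w - w))]
      _ ≤ ‖Γ y‖ * (P * ‖w‖ ^ 2) * (P * ‖w‖ ^ 2) := ((Γ y).le_opNorm₂ _ _).trans (by gcongr)
      _ = _ := by ring
  have h := norm_sub_le_of_le (norm_sub_le_of_le hJ hB) hQ
  linarith

/-- A geodesic is approximated at time one by its third-order Taylor polynomial, up to `O(s⁴)` for
velocities bounded by `s`. -/
theorem exists_norm_geodesic_sub_taylor_three_le {Γ : E → E →L[ℝ] E →L[ℝ] E} (hΓ : ContDiff ℝ 2 Γ)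
    (y : E) :
    ∃ U ∈ 𝓝 y, ∃ C ≥ (0 : ℝ), ∀ (γ dγ : ℝ → E) (s : ℝ), γ 0 = y →
      (∀ t ∈ Icc (0 : ℝ) 1, HasDerivAt γ (dγ t) t ∧
        HasDerivAt dγ (-(Γ (γ t) (dγ t) (dγ t))) t ∧ γ t ∈ U ∧ ‖dγ t‖ ≤ s) →
      ‖γ 1 - (y + dγ 0 + (1 / 2 : ℝ) • -(Γ y (dγ 0) (dγ 0)) +
        (1 / 6 : ℝ) • geodesicJerk Γ y (dγ 0))‖ ≤ C * s ^ 4 := by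
  obtain ⟨U, hU, K, hK, hlip⟩ := exists_norm_sub_le_of_homogeneous_three (geodesicJerk_smul Γ)
    (contDiff_geodesicJerk hΓ).contDiffAt (y := y)
  have hMU : ∀ᶠ x in 𝓝 y, ‖Γ x‖ < ‖Γ y‖ + 1 :=
    hΓ.continuous.norm.continuousAt.eventually_lt continuousAt_const (lt_add_one _)
  set M := ‖Γ y‖ + 1 with hM
  have hM0 : 0 ≤ M := by positivity
  refine ⟨_, Filter.inter_mem hU hMU, K * (1 + M), by positivity, fun γ dγ s h0 h ↦ ?_⟩
  have hz : (0 : ℝ) ∈ Icc (0 : ℝ) 1 := left_mem_Icc.2 zero_le_one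
  have hs : 0 ≤ s := (norm_nonneg _).trans (h 0 hz).2.2.2
  have hosc : ∀ t ∈ Icc (0 : ℝ) 1, ‖γ t - γ 0‖ ≤ s :=
    norm_sub_le_of_norm_deriv_sub_le (g := fun _ ↦ γ 0) (fun t ht ↦ (h t ht).1)
      (fun t _ ↦ hasDerivAt_const t _) rfl (fun t ht ↦ by simpa using (h t ht).2.2.2)
  have hdosc : ∀ t ∈ Icc (0 : ℝ) 1, ‖dγ t - dγ 0‖ ≤ M * s ^ 2 :=
    norm_sub_le_of_norm_deriv_sub_le (g := fun _ ↦ dγ 0) (fun t ht ↦ (h t ht).2.1)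
      (fun t _ ↦ hasDerivAt_const t _) rfl (fun t ht ↦ by
        obtain ⟨-, -, ⟨-, hΓt⟩, hv⟩ := h t ht
        rw [sub_zero, norm_neg, sq, ← mul_assoc]
        refine ((Γ (γ t)).le_opNorm₂ _ _).trans ?_
        gcongr
        exact le_of_lt hΓt)
  have := norm_sub_taylor_three_le (fun t ht ↦ (h t ht).1) (fun t ht ↦ (h t ht).2.1)
    (fun t ht ↦ hasDerivAt_geodesic_acceleration (hΓ.differentiable (by norm_num))
      (h t ht).1 (h t ht).2.1)
    (B := K * (1 + M) * s ^ 4) (fun t ht ↦ by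
      refine (hlip _ (h t ht).2.2.1.1 _ (h 0 hz).2.2.1.1 s _ _ (h t ht).2.2.2
        (h 0 hz).2.2.2).trans ?_
      calc _ ≤ K * s ^ 2 * (s * s + M * s ^ 2) := by
            gcongr
            exacts [hosc t ht, hdosc t ht]
        _ = _ := by ring)
  rwa [h0] at this

end GeodesicTaylor

theorem stmt16 (p : ℕ)
    (Γ : EuclideanSpace ℝ (Fin p) →
      EuclideanSpace ℝ (Fin p) →L[ℝ] EuclideanSpace ℝ (Fin p) →L[ℝ] EuclideanSpace ℝ (Fin p))
    (hΓ : ContDiff ℝ 2 Γ)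
    (hΓsymm : ∀ x u v, Γ x u v = Γ x v u)
    (y : EuclideanSpace ℝ (Fin p)) :
    ∃ r > (0:ℝ), ∃ C > (0:ℝ), ∀ w : EuclideanSpace ℝ (Fin p), ‖w‖ < r →
      ∃ γ dγ : ℝ → EuclideanSpace ℝ (Fin p),
        γ 0 = y ∧
        dγ 0 = w + (1 / 2 : ℝ) • Γ y w w
          + (1 / 6 : ℝ) • (fderiv ℝ Γ y w w w + Γ y (Γ y w w) w) ∧
        (∀ t ∈ Set.Icc (0:ℝ) 1,
          HasDerivAt γ (dγ t) t ∧ HasDerivAt dγ (-(Γ (γ t) (dγ t) (dγ t))) t) ∧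
        ‖γ 1 - (y + w)‖ ≤ C * ‖w‖ ^ 4 := by
  obtain ⟨U, hU, C₁, hC₁, htaylor⟩ := exists_norm_geodesic_sub_taylor_three_le hΓ y
  obtain ⟨ρ, hρ, K, hK, hgeo⟩ := exists_geodesic (hΓ.of_le one_le_two) y hU
  obtain ⟨C₂, hC₂, halg⟩ := exists_norm_taylor_three_geodesic_invExpTaylor_le hΓ hΓsymm y
  obtain ⟨P, hP, hbound⟩ := exists_norm_invExpTaylor_sub_le Γ y
  refine ⟨min 1 (ρ / (1 + P)), by positivity, C₁ * (K * (1 + P)) ^ 4 + C₂ + 1, by positivity,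
    fun w hw ↦ ?_⟩
  have hw1 : ‖w‖ ≤ 1 := hw.le.trans (min_le_left _ _)
  have hv := (hbound w hw1).2.2
  obtain ⟨γ, dγ, h0, hd0, h⟩ := hgeo (invExpTaylor Γ y w) (hv.trans (by
    rw [mul_comm, ← le_div_iff₀ (by positivity)]
    exact hw.le.trans (min_le_right _ _)))
  refine ⟨γ, dγ, h0, hd0, fun t ht ↦ ⟨(h t ht).1, (h t ht).2.1⟩, ?_⟩
  have h1 := htaylor γ dγ (K * (1 + P) * ‖w‖) h0 (fun t ht ↦
    ⟨(h t ht).1, (h t ht).2.1, (h t ht).2.2.1, (h t ht).2.2.2.trans (by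
      rw [mul_assoc]
      gcongr)⟩)
  have h2 := halg w hw1
  rw [hd0] at h1
  have h3 := norm_add_le_of_le h1 h2
  have e (a v q j : EuclideanSpace ℝ (Fin p)) :
      a - (y + v + q + j) + (v + q + j - w) = a - (y + w) := by abel
  rw [e] at h3
  nlinarith [pow_nonneg (norm_nonneg w) 4]
end
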